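/- Vertex expansion theorem for random 0/1 polytopes: if P is the convex hull of n points chosen independently and uniformly at random from {0,1}^d, then there is a constant C > 0 such that with probability tending to 1 as d → ∞, the vertex expansion of the graph of P is at least C/d^{3/2}. -/

import Mathlib

open scoped BigOperators Classical

/-- A face of `P ⊆ ℝ^d`: the subset of `P` where a linear functional valid on `P`
attains the value `c₀`. -/
def IsFaceOf {d : ℕ} (P F : Set (Fin d → ℝ)) : Prop :=
  ∃ (c : Fin d → ℝ) (c₀ : ℝ), (∀ x ∈ P, ∑ i, c i * x i ≤ c₀) ∧
    F = {x ∈ P | ∑ i, c i * x i = c₀}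

/-- A vertex of `P` is a point whose singleton is a face of `P`. -/
def IsVertexOf {d : ℕ} (P : Set (Fin d → ℝ)) (v : Fin d → ℝ) : Prop := IsFaceOf P {v}

/-- An edge of `P` is a segment between two distinct points that is a face of `P`. -/
def IsEdgeOf {d : ℕ} (P : Set (Fin d → ℝ)) (u v : Fin d → ℝ) : Prop :=
  u ≠ v ∧ IsFaceOf P (segment ℝ u v)

/-- The vertex set of `P`. -/
def polyVerts {d : ℕ} (P : Set (Fin d → ℝ)) : Set (Fin d → ℝ) := {v | IsVertexOf P v}

/-- The outside neighborhood of `S` in the graph of `P`: vertices of `P` not in `S`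
joined by an edge of `P` to some vertex in `S`. -/
def polyNbhd {d : ℕ} (P S : Set (Fin d → ℝ)) : Set (Fin d → ℝ) :=
  {v | IsVertexOf P v ∧ v ∉ S ∧ ∃ u ∈ S, IsEdgeOf P u v}

/-- The vertex expansion of the graph of `P` is at least `α`. -/
def VertexExpansionAtLeast {d : ℕ} (P : Set (Fin d → ℝ)) (α : ℝ) : Prop :=
  ∀ S : Set (Fin d → ℝ), S ⊆ polyVerts P → S.Nonempty →
    2 * S.ncard ≤ (polyVerts P).ncard → α * S.ncard ≤ (polyNbhd P S).ncard

/-- The embedding of `{0,1}^d` (as `Fin d → Fin 2`) into `ℝ^d`. -/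
def toCube {d : ℕ} (w : Fin d → Fin 2) : Fin d → ℝ := fun i => ((w i : ℕ) : ℝ)

/-! ### Vertex isoperimetry in the discrete cube -/

/-- The neighbour of `x` in the cube obtained by flipping coordinate `i`. -/
def flipAt {k : ℕ} (x : Fin k → Fin 2) (i : Fin k) : Fin k → Fin 2 :=
  Function.update x i (x i + 1)

/-- The number of neighbours outside `A` of a point of `A`, and `0` at points outside `A`. -/
noncomputable def exitDegree {k : ℕ} (A : Finset (Fin k → Fin 2)) (x : Fin k → Fin 2) : ℕ :=
  (Finset.univ.filter fun i => x ∈ A ∧ flipAt x i ∉ A).card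

/-- The slice of `A` where the first coordinate equals `b`. -/
noncomputable def slice {k : ℕ} (A : Finset (Fin (k + 1) → Fin 2)) (b : Fin 2) :
    Finset (Fin k → Fin 2) :=
  Finset.univ.filter fun x => (Fin.cons b x : Fin (k + 1) → Fin 2) ∈ A

lemma mem_slice {k : ℕ} {A : Finset (Fin (k + 1) → Fin 2)} {b : Fin 2} {x : Fin k → Fin 2} :
    x ∈ slice A b ↔ (Fin.cons b x : Fin (k + 1) → Fin 2) ∈ A := by
  simp [slice]

lemma sum_cube_succ {k : ℕ} (f : (Fin (k + 1) → Fin 2) → ℝ) :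
    ∑ x, f x = ∑ x, f (Fin.cons 0 x) + ∑ x, f (Fin.cons 1 x) := by
  rw [← (Fin.consEquiv fun _ : Fin (k + 1) => Fin 2).sum_comp, Fintype.sum_prod_type,
    Fin.sum_univ_two]
  rfl

lemma card_slice_add {k : ℕ} (A : Finset (Fin (k + 1) → Fin 2)) :
    (A.card : ℝ) = (slice A 0).card + (slice A 1).card := by
  have h := sum_cube_succ fun x => if x ∈ A then (1 : ℝ) else 0
  simpa [slice, Finset.sum_boole] using h

lemma exitDegree_cons {k : ℕ} (A : Finset (Fin (k + 1) → Fin 2)) (b : Fin 2)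
    (x : Fin k → Fin 2) :
    exitDegree A (Fin.cons b x) =
      (if x ∈ slice A b ∧ x ∉ slice A (b + 1) then 1 else 0) + exitDegree (slice A b) x := by
  have hz : flipAt (Fin.cons b x : Fin (k + 1) → Fin 2) 0 = Fin.cons (b + 1) x := by
    simp [flipAt]
  have hs : ∀ i, flipAt (Fin.cons b x : Fin (k + 1) → Fin 2) (Fin.succ i) =
      Fin.cons b (flipAt x i) := by
    intro i
    simp [flipAt, Fin.cons_update]
  simp only [exitDegree, Finset.card_filter, Fin.sum_univ_succ, hz, hs, mem_slice]

lemma sqrt_sum_sq_add_sum_sq_le {ι : Type*} (s : Finset ι) (u v : ι → ℝ) :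
    Real.sqrt ((∑ i ∈ s, u i) ^ 2 + (∑ i ∈ s, v i) ^ 2) ≤
      ∑ i ∈ s, Real.sqrt (u i ^ 2 + v i ^ 2) := by
  have h := norm_sum_le s fun i => (u i : ℂ) + v i * Complex.I
  simp only [Complex.norm_add_mul_I] at h
  rwa [Finset.sum_add_distrib, ← Finset.sum_mul, ← Complex.ofReal_sum, ← Complex.ofReal_sum,
    Complex.norm_add_mul_I] at h

lemma two_point_inequality {N a b s t : ℝ} (hN : 0 < N) (haN : a ≤ N) (hb : 0 ≤ b)
    (hab : b ≤ a) (hs : a * (N - a) ≤ N * s) (ht : b * (N - b) ≤ N * t) :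
    (a + b) * (2 * N - (a + b)) ≤ 2 * N * (Real.sqrt (s ^ 2 + (a - b) ^ 2) + t) := by
  have hJ : 0 ≤ a * (N - a) := mul_nonneg (hb.trans hab) (by linarith)
  have hkey : 2 * (a * (N - a)) + (a - b) ^ 2 ≤ 2 * N * Real.sqrt (s ^ 2 + (a - b) ^ 2) := by
    have hroot : 2 * N * Real.sqrt (s ^ 2 + (a - b) ^ 2) =
        Real.sqrt ((2 * N) ^ 2 * (s ^ 2 + (a - b) ^ 2)) := by
      rw [Real.sqrt_mul (by positivity), Real.sqrt_sq (by positivity)]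
    rw [hroot]
    apply Real.le_sqrt_of_sq_le
    have hsq : (a * (N - a)) ^ 2 ≤ (N * s) ^ 2 := pow_le_pow_left₀ hJ hs 2
    have hδ : (a - b) ^ 2 ≤ N ^ 2 := pow_le_pow_left₀ (by linarith) (by linarith) 2
    have hq : 4 * (a * (N - a)) + (a - b) ^ 2 ≤ 4 * N ^ 2 := by
      nlinarith [sq_nonneg (N - 2 * a)]
    nlinarith [mul_le_mul_of_nonneg_right hq (sq_nonneg (a - b))]
  nlinarith

lemma sum_sqrt_exitDegree_cons {k : ℕ} (A : Finset (Fin (k + 1) → Fin 2)) (b : Fin 2) :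
    ∑ x, Real.sqrt (exitDegree (slice A b) x) ≤
      ∑ x, Real.sqrt (exitDegree A (Fin.cons b x)) := by
  refine Finset.sum_le_sum fun x _ => Real.sqrt_le_sqrt ?_
  rw [exitDegree_cons]
  exact_mod_cast Nat.le_add_left _ _

lemma sqrt_sum_exitDegree_cons_le {k : ℕ} (A : Finset (Fin (k + 1) → Fin 2)) (b : Fin 2)
    (h : (slice A (b + 1)).card ≤ (slice A b).card) :
    Real.sqrt ((∑ x, Real.sqrt (exitDegree (slice A b) x)) ^ 2 +
        (((slice A b).card : ℝ) - (slice A (b + 1)).card) ^ 2) ≤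
      ∑ x, Real.sqrt (exitDegree A (Fin.cons b x)) := by
  have hcard : ((slice A b).card : ℝ) - (slice A (b + 1)).card ≤
      ∑ x, if x ∈ slice A b ∧ x ∉ slice A (b + 1) then (1 : ℝ) else 0 := by
    rw [Finset.sum_boole, sub_le_iff_le_add]
    have hsub : slice A b \ slice A (b + 1) =
        Finset.univ.filter fun x => x ∈ slice A b ∧ x ∉ slice A (b + 1) := by
      ext x; simp
    rw [← hsub]
    exact_mod_cast Finset.card_le_card_sdiff_add_card
  have hnonneg : (0 : ℝ) ≤ ((slice A b).card : ℝ) - (slice A (b + 1)).card :=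
    sub_nonneg.2 (by exact_mod_cast h)
  calc _ ≤ Real.sqrt ((∑ x, Real.sqrt (exitDegree (slice A b) x)) ^ 2 +
        (∑ x, if x ∈ slice A b ∧ x ∉ slice A (b + 1) then (1 : ℝ) else 0) ^ 2) := by
        gcongr
    _ ≤ _ := sqrt_sum_sq_add_sum_sq_le _ _ _
    _ = _ := by
        refine Finset.sum_congr rfl fun x _ => ?_
        rw [exitDegree_cons, Real.sq_sqrt (Nat.cast_nonneg _)]
        congr 1
        push_cast
        split_ifs <;> ring

/-- A Talagrand-type isoperimetric inequality in the cube: the expectation of the square root of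
the number of exits is at least the variance of the indicator function. -/
theorem card_mul_le_sum_sqrt_exitDegree (k : ℕ) (A : Finset (Fin k → Fin 2)) :
    (A.card : ℝ) * (2 ^ k - A.card) ≤ 2 ^ k * ∑ x, Real.sqrt (exitDegree A x) := by
  induction k with
  | zero =>
    have h1 : A.card ≤ 1 := by simpa using Finset.card_le_univ A
    interval_cases A.card <;> simp
  | succ k ih =>
    have hle : ∀ b, ((slice A b).card : ℝ) ≤ 2 ^ k := fun b => by
      exact_mod_cast (by simpa using Finset.card_le_univ (slice A b) :
        (slice A b).card ≤ 2 ^ k)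
    have hN : (0 : ℝ) < 2 ^ k := by positivity
    rw [sum_cube_succ, card_slice_add, pow_succ]
    have h0 := sum_sqrt_exitDegree_cons A 0
    have h1 := sum_sqrt_exitDegree_cons A 1
    rcases le_total (slice A 0).card (slice A 1).card with h | h
    · have hroot := sqrt_sum_exitDegree_cons_le A 1 h
      have htwo := two_point_inequality hN (hle 1) (Nat.cast_nonneg _)
        (Nat.cast_le.2 h) (ih (slice A 1)) (ih (slice A 0))
      have hadd := mul_le_mul_of_nonneg_left (add_le_add hroot h0) (by positivity :
        (0 : ℝ) ≤ 2 * 2 ^ k)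
      rw [show (1 : Fin 2) + 1 = 0 from rfl] at hadd
      linarith
    · have hroot := sqrt_sum_exitDegree_cons_le A 0 h
      have htwo := two_point_inequality hN (hle 0) (Nat.cast_nonneg _)
        (Nat.cast_le.2 h) (ih (slice A 0)) (ih (slice A 1))
      have hadd := mul_le_mul_of_nonneg_left (add_le_add hroot h1) (by positivity :
        (0 : ℝ) ≤ 2 * 2 ^ k)
      rw [show (0 : Fin 2) + 1 = 1 from rfl] at hadd
      linarith

/-- If `N` contains every point of `A` having a neighbour outside `A`, then
`|A| |Aᶜ| ≤ 2 ^ k √k |N|`. -/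
theorem card_mul_le_of_innerBoundary_subset {k : ℕ} (A N : Finset (Fin k → Fin 2))
    (hN : ∀ x ∈ A, ∀ i, flipAt x i ∉ A → x ∈ N) :
    (A.card : ℝ) * (2 ^ k - A.card) ≤ 2 ^ k * (Real.sqrt k * N.card) := by
  refine (card_mul_le_sum_sqrt_exitDegree k A).trans ?_
  gcongr
  have hpoint : ∀ x, Real.sqrt (exitDegree A x) ≤ if x ∈ N then Real.sqrt k else 0 := by
    intro x
    split_ifs with hx
    · apply Real.sqrt_le_sqrt
      have hle : exitDegree A x ≤ k := (Finset.card_filter_le _ _).trans_eq (by simp)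
      exact_mod_cast hle
    · have : exitDegree A x = 0 := by
        simp only [exitDegree, Finset.card_eq_zero, Finset.filter_eq_empty_iff]
        exact fun i _ h => hx (hN x h.1 i h.2)
      simp [this]
  refine (Finset.sum_le_sum fun x _ => hpoint x).trans_eq ?_
  simp [Finset.sum_ite_mem, mul_comm]

/-! ### Faces of 0/1 polytopes -/

/-- `F` is the set of maximizers over `W` of a linear functional. -/
def IsCubeFace {d : ℕ} (W F : Finset (Fin d → Fin 2)) : Prop :=
  ∃ (c : Fin d → ℝ) (c₀ : ℝ), (∀ w ∈ W, c ⬝ᵥ toCube w ≤ c₀) ∧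
    F = W.filter fun w => c ⬝ᵥ toCube w = c₀

lemma toCube_injective {d : ℕ} : Function.Injective (toCube (d := d)) := by
  intro u v h
  ext i
  have := congrFun h i
  simpa [toCube] using this

/-- The functional `∑ (2 z i - 1) x i` restricted to the coordinates satisfying `p`. -/
noncomputable def signFunctional {d : ℕ} (p : Fin d → Prop) (z : Fin d → Fin 2) : Fin d → ℝ :=
  fun i => if p i then 2 * toCube z i - 1 else 0

lemma signFunctional_le {d : ℕ} (p : Fin d → Prop) (z w : Fin d → Fin 2) :
    signFunctional p z ⬝ᵥ toCube w ≤ signFunctional p z ⬝ᵥ toCube z ∧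
      (signFunctional p z ⬝ᵥ toCube w = signFunctional p z ⬝ᵥ toCube z ↔
        ∀ i, p i → w i = z i) := by
  have hterm : ∀ i, signFunctional p z i * toCube w i ≤ signFunctional p z i * toCube z i ∧
      (signFunctional p z i * toCube w i = signFunctional p z i * toCube z i ↔
        (p i → w i = z i)) := by
    intro i
    by_cases hp : p i
    · simp only [signFunctional, toCube, hp, if_true]
      generalize w i = a
      generalize z i = b
      fin_cases a <;> fin_cases b <;> norm_num
    · simp [signFunctional, hp]
  refine ⟨Finset.sum_le_sum fun i _ => (hterm i).1, ?_⟩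
  rw [dotProduct, dotProduct, Finset.sum_eq_sum_iff_of_le fun i _ => (hterm i).1]
  simp [(hterm _).2]

/-- Fixing the coordinates satisfying `p` to their values at `z` cuts out a face. -/
lemma isCubeFace_filter {d : ℕ} (W : Finset (Fin d → Fin 2)) (p : Fin d → Prop)
    [DecidablePred p] (z : Fin d → Fin 2) : IsCubeFace W (W.filter fun w => ∀ i, p i → w i = z i) := by
  refine ⟨signFunctional p z, signFunctional p z ⬝ᵥ toCube z,
    fun w _ => (signFunctional_le p z w).1, ?_⟩
  simp only [(signFunctional_le p z _).2]

lemma isCubeFace_singleton {d : ℕ} {W : Finset (Fin d → Fin 2)} {z : Fin d → Fin 2}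
    (hz : z ∈ W) : IsCubeFace W {z} := by
  convert isCubeFace_filter W (fun _ => True) z
  ext w
  rw [Finset.mem_singleton, Finset.mem_filter]
  exact ⟨fun h => ⟨h ▸ hz, fun i _ => congrFun h i⟩, fun h => funext fun i => h.2 i trivial⟩

lemma IsCubeFace.trans {d : ℕ} {W F G : Finset (Fin d → Fin 2)} (hF : IsCubeFace W F)
    (hG : IsCubeFace F G) : IsCubeFace W G := by
  obtain ⟨c, c₀, hc, rfl⟩ := hF
  obtain ⟨b, b₀, hb, rfl⟩ := hG
  obtain ⟨K, hK⟩ := (W.image fun w => (b ⬝ᵥ toCube w - b₀) / (c₀ - c ⬝ᵥ toCube w)).exists_le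
  have hlin : ∀ w, ((K + 1) • c + b) ⬝ᵥ toCube w = (K + 1) * (c ⬝ᵥ toCube w) + b ⬝ᵥ toCube w := by
    intro w
    rw [add_dotProduct, smul_dotProduct, smul_eq_mul]
  have hstrict : ∀ w ∈ W, c ⬝ᵥ toCube w ≠ c₀ →
      (K + 1) * (c ⬝ᵥ toCube w) + b ⬝ᵥ toCube w < (K + 1) * c₀ + b₀ := by
    intro w hw hne
    have hpos : 0 < c₀ - c ⬝ᵥ toCube w := sub_pos.2 (lt_of_le_of_ne (hc w hw) hne)
    have := (div_le_iff₀ hpos).1 (hK _ (Finset.mem_image_of_mem _ hw))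
    nlinarith
  refine ⟨(K + 1) • c + b, (K + 1) * c₀ + b₀, fun w hw => ?_, ?_⟩
  · rw [hlin]
    by_cases h : c ⬝ᵥ toCube w = c₀
    · rw [h]
      linarith [hb w (Finset.mem_filter.2 ⟨hw, h⟩)]
    · exact (hstrict w hw h).le
  · ext w
    simp only [Finset.mem_filter, hlin, and_assoc]
    refine and_congr_right fun hw => ⟨fun h => by rw [h.1, h.2], fun h => ?_⟩
    by_cases hcw : c ⬝ᵥ toCube w = c₀
    · exact ⟨hcw, by rw [hcw] at h; linarith⟩
    · exact absurd h (hstrict w hw hcw).ne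

/-- If no proper face of `F` meets both the set `p` and its complement, and `a`, `b` are maximized
only at a point of `p` and only at a point outside `p`, then `b` is a negative multiple of `a` up
to a constant on `F`. -/
lemma exists_proportional {d : ℕ} {F : Finset (Fin d → Fin 2)} {p : (Fin d → Fin 2) → Prop}
    (hmin : ∀ G, IsCubeFace F G → (∃ u ∈ G, p u) → (∃ v ∈ G, ¬ p v) → G = F)
    {u v : Fin d → Fin 2} (hu : u ∈ F) (hv : v ∈ F) (hpu : p u) (hpv : ¬ p v)
    {a b : Fin d → ℝ} (ha : ∀ w ∈ F, w ≠ u → a ⬝ᵥ toCube w < a ⬝ᵥ toCube u)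
    (hb : ∀ w ∈ F, w ≠ v → b ⬝ᵥ toCube w < b ⬝ᵥ toCube v) :
    ∃ t m : ℝ, 0 < t ∧ t < 1 ∧
      ∀ w ∈ F, (1 - t) * (a ⬝ᵥ toCube w) + t * (b ⬝ᵥ toCube w) = m := by
  have huF : (F.filter p).Nonempty := ⟨u, Finset.mem_filter.2 ⟨hu, hpu⟩⟩
  have hvF : (F.filter fun w => ¬ p w).Nonempty := ⟨v, Finset.mem_filter.2 ⟨hv, hpv⟩⟩
  let f : ℝ → (Fin d → Fin 2) → ℝ := fun t w => (1 - t) * (a ⬝ᵥ toCube w) + t * (b ⬝ᵥ toCube w)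
  have hf : ∀ w, Continuous fun t => f t w := fun w => by
    simp only [f]
    fun_prop
  let g : ℝ → ℝ := fun t => (F.filter fun w => ¬ p w).sup' hvF (f t) - (F.filter p).sup' huF (f t)
  have hg : Continuous g :=
    (Continuous.finset_sup'_apply hvF fun w _ => hf w).sub
      (Continuous.finset_sup'_apply huF fun w _ => hf w)
  have hne : ∀ w, ¬ p w → w ≠ u := fun w hw h => hw (h ▸ hpu)
  have hne' : ∀ w, p w → w ≠ v := fun w hw h => hpv (h ▸ hw)
  have hg0 : g 0 < 0 := by
    refine sub_neg.2 ((Finset.sup'_lt_iff hvF).2 fun w hw => ?_)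
    rw [Finset.mem_filter] at hw
    refine lt_of_lt_of_le ?_ (Finset.le_sup' (f 0) (Finset.mem_filter.2 ⟨hu, hpu⟩))
    simpa [f] using ha w hw.1 (hne w hw.2)
  have hg1 : 0 < g 1 := by
    refine sub_pos.2 ((Finset.sup'_lt_iff huF).2 fun w hw => ?_)
    rw [Finset.mem_filter] at hw
    refine lt_of_lt_of_le ?_ (Finset.le_sup' (f 1) (Finset.mem_filter.2 ⟨hv, hpv⟩))
    simpa [f] using hb w hw.1 (hne' w hw.2)
  obtain ⟨t, ht, hgt⟩ := intermediate_value_Icc zero_le_one hg.continuousOn ⟨hg0.le, hg1.le⟩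
  have ht0 : t ≠ 0 := by rintro rfl; exact hg0.ne hgt
  have ht1 : t ≠ 1 := by rintro rfl; exact hg1.ne' hgt
  obtain ⟨x, hx, hxm⟩ := Finset.exists_mem_eq_sup' huF (f t)
  obtain ⟨y, hy, hym⟩ := Finset.exists_mem_eq_sup' hvF (f t)
  have hxy : f t y = f t x := by rw [← hxm, ← hym]; exact sub_eq_zero.1 hgt
  rw [Finset.mem_filter] at hx hy
  have hlin : ∀ w, ((1 - t) • a + t • b) ⬝ᵥ toCube w = f t w := fun w => by
    simp [f, add_dotProduct, smul_dotProduct]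
  have hface : IsCubeFace F (F.filter fun w => f t w = f t x) := by
    refine ⟨(1 - t) • a + t • b, f t x, fun w hw => ?_, by simp only [hlin]⟩
    rw [hlin]
    by_cases hpw : p w
    · rw [← hxm]
      exact Finset.le_sup' (f t) (Finset.mem_filter.2 ⟨hw, hpw⟩)
    · rw [← hxy, ← hym]
      exact Finset.le_sup' (f t) (Finset.mem_filter.2 ⟨hw, hpw⟩)
  have hall := hmin _ hface ⟨x, Finset.mem_filter.2 ⟨hx.1, rfl⟩, hx.2⟩
    ⟨y, Finset.mem_filter.2 ⟨hy.1, hxy⟩, hy.2⟩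
  refine ⟨t, f t x, lt_of_le_of_ne ht.1 ht0.symm, lt_of_le_of_ne ht.2 ht1, fun w hw => ?_⟩
  rw [← hall] at hw
  exact (Finset.mem_filter.1 hw).2

lemma signFunctional_lt {d : ℕ} {u w : Fin d → Fin 2} (h : w ≠ u) :
    signFunctional (fun _ => True) u ⬝ᵥ toCube w <
      signFunctional (fun _ => True) u ⬝ᵥ toCube u := by
  obtain ⟨hle, heq⟩ := signFunctional_le (fun _ => True) u w
  exact lt_of_le_of_ne hle fun he => h (funext fun i => heq.1 he i trivial)

/-- Among points of a face with no bichromatic proper face, each colour occurs at most once. -/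
lemma eq_of_minimal_face {d : ℕ} {F : Finset (Fin d → Fin 2)} {p : (Fin d → Fin 2) → Prop}
    (hmin : ∀ G, IsCubeFace F G → (∃ u ∈ G, p u) → (∃ v ∈ G, ¬ p v) → G = F)
    {x y z : Fin d → Fin 2} (hx : x ∈ F) (hy : y ∈ F) (hz : z ∈ F) (hpx : p x) (hpy : p y)
    (hpz : ¬ p z) : x = y := by
  by_contra hne
  obtain ⟨t, m, ht0, ht1, ht⟩ := exists_proportional hmin hx hz hpx hpz
    (fun w _ => signFunctional_lt) (fun w _ => signFunctional_lt)
  obtain ⟨s, l, hs0, hs1, hs⟩ := exists_proportional hmin hy hz hpy hpz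
    (fun w _ => signFunctional_lt) (fun w _ => signFunctional_lt)
  have hxy := signFunctional_lt hne
  have hyx := signFunctional_lt (Ne.symm hne)
  have htx := ht x hx
  have hty := ht y hy
  have hsx := hs x hx
  have hsy := hs y hy
  set c := signFunctional (fun _ => True) z
  have h1 : c ⬝ᵥ toCube x < c ⬝ᵥ toCube y := by
    have := mul_lt_mul_of_pos_left hyx (sub_pos.2 ht1)
    exact lt_of_mul_lt_mul_left (by linarith) ht0.le
  have h2 : c ⬝ᵥ toCube y < c ⬝ᵥ toCube x := by
    have := mul_lt_mul_of_pos_left hxy (sub_pos.2 hs1)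
    exact lt_of_mul_lt_mul_left (by linarith) hs0.le
  exact lt_asymm h1 h2

/-- Connectivity of faces: a bichromatic face contains a bichromatic edge. -/
theorem exists_bichromatic_edge {d : ℕ} {W : Finset (Fin d → Fin 2)}
    {p : (Fin d → Fin 2) → Prop} (F : Finset (Fin d → Fin 2)) (hF : IsCubeFace W F)
    (hu : ∃ u ∈ F, p u) (hv : ∃ v ∈ F, ¬ p v) :
    ∃ u ∈ F, ∃ v ∈ F, p u ∧ ¬ p v ∧ IsCubeFace W {u, v} := by
  induction F using Finset.strongInduction with
  | H F ih =>
    by_cases hmin : ∀ G, IsCubeFace F G → (∃ u ∈ G, p u) → (∃ v ∈ G, ¬ p v) → G = F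
    · obtain ⟨u, huF, hpu⟩ := hu
      obtain ⟨v, hvF, hpv⟩ := hv
      refine ⟨u, huF, v, hvF, hpu, hpv, ?_⟩
      have hmin' : ∀ G, IsCubeFace F G → (∃ u ∈ G, ¬ p u) → (∃ v ∈ G, ¬ ¬ p v) → G = F :=
        fun G hG h1 h2 => hmin G hG (by simpa using h2) h1
      convert hF
      ext w
      simp only [Finset.mem_insert, Finset.mem_singleton]
      refine ⟨by rintro (rfl | rfl) <;> assumption, fun hw => ?_⟩
      by_cases hpw : p w
      · exact Or.inl (eq_of_minimal_face hmin hw huF hvF hpw hpu hpv)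
      · exact Or.inr (eq_of_minimal_face hmin' hw hvF huF hpw hpv (not_not.2 hpu))
    · push Not at hmin
      obtain ⟨G, hG, hGu, hGv, hne⟩ := hmin
      have hsub : G ⊆ F := by
        obtain ⟨c, c₀, -, rfl⟩ := hG
        exact Finset.filter_subset _ _
      obtain ⟨u, hu, v, hv, h⟩ := ih G (lt_of_le_of_ne hsub hne) (hF.trans hG) hGu hGv
      exact ⟨u, hsub hu, v, hsub hv, h⟩

lemma IsCubeFace.isFaceOf {d : ℕ} {W F : Finset (Fin d → Fin 2)} (hF : IsCubeFace W F) :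
    IsFaceOf (convexHull ℝ (toCube '' (W : Set (Fin d → Fin 2))))
      (convexHull ℝ (toCube '' (F : Set (Fin d → Fin 2)))) := by
  obtain ⟨c, c₀, hc, hFeq⟩ := hF
  have hsub : F ⊆ W := hFeq ▸ Finset.filter_subset _ _
  have hmem : ∀ w, w ∈ F ↔ w ∈ W ∧ c ⬝ᵥ toCube w = c₀ := fun w => by
    rw [hFeq, Finset.mem_filter]
  have hconv : Convex ℝ {x : Fin d → ℝ | c ⬝ᵥ x ≤ c₀ ∧
      (c ⬝ᵥ x = c₀ → x ∈ convexHull ℝ (toCube '' (F : Set (Fin d → Fin 2))))} := by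
    rintro x ⟨hx, hxF⟩ y ⟨hy, hyF⟩ r s hr hs hrs
    have hlin : c ⬝ᵥ (r • x + s • y) = r * (c ⬝ᵥ x) + s * (c ⬝ᵥ y) := by
      simp [dotProduct_add, dotProduct_smul]
    obtain rfl : s = 1 - r := by linarith
    rw [Set.mem_ofPred_eq, hlin]
    refine ⟨by nlinarith, fun h => ?_⟩
    rcases hr.eq_or_lt with rfl | hr'
    · simpa using hyF (by simpa using h)
    rcases hs.eq_or_lt with hs' | hs'
    · obtain rfl : r = 1 := by linarith
      simpa using hxF (by simpa using h)
    refine convex_convexHull ℝ _ (hxF (hx.antisymm ?_)) (hyF (hy.antisymm ?_)) hr hs hrs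
    · by_contra! hlt
      nlinarith
    · by_contra! hlt
      nlinarith
  have hmin := convexHull_min (s := toCube '' (W : Set (Fin d → Fin 2))) (by
    rintro _ ⟨w, hw, rfl⟩
    exact ⟨hc w hw, fun h => subset_convexHull ℝ _ ⟨w, (hmem w).2 ⟨hw, h⟩, rfl⟩⟩) hconv
  refine ⟨c, c₀, fun x hx => (hmin hx).1, Set.Subset.antisymm (fun x hx => ?_)
    fun x hx => (hmin hx.1).2 hx.2⟩
  refine ⟨convexHull_mono (Set.image_mono (by exact_mod_cast hsub)) hx, ?_⟩
  have hplane : Convex ℝ {x : Fin d → ℝ | c ⬝ᵥ x = c₀} :=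
    convex_hyperplane ⟨fun x y => dotProduct_add c x y, fun r x => dotProduct_smul r c x⟩ c₀
  exact convexHull_min (by
    rintro _ ⟨w, hw, rfl⟩
    exact ((hmem w).1 hw).2) hplane hx

/-- The vertices of a 0/1 polytope are its defining points. -/
lemma polyVerts_convexHull_toCube {d : ℕ} (W : Finset (Fin d → Fin 2)) :
    polyVerts (convexHull ℝ (toCube '' (W : Set (Fin d → Fin 2)))) =
      toCube '' (W : Set (Fin d → Fin 2)) := by
  refine Set.Subset.antisymm ?_ ?_
  · rintro v ⟨c, c₀, hc, hv⟩
    have hvP : v ∈ convexHull ℝ (toCube '' (W : Set (Fin d → Fin 2))) ∧ c ⬝ᵥ v = c₀ :=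
      hv.le (Set.mem_singleton v)
    by_contra hnot
    have hhalf : Convex ℝ {x : Fin d → ℝ | c ⬝ᵥ x < c₀} :=
      convex_halfSpace_lt ⟨fun x y => dotProduct_add c x y, fun r x => dotProduct_smul r c x⟩ c₀
    refine (convexHull_min (fun x hx => ?_) hhalf hvP.1).ne hvP.2
    refine lt_of_le_of_ne (hc x (subset_convexHull ℝ _ hx)) fun h => hnot ?_
    have : x = v := hv.ge ⟨subset_convexHull ℝ _ hx, h⟩
    exact this ▸ hx
  · rintro _ ⟨w, hw, rfl⟩
    simpa [IsVertexOf, polyVerts] using (isCubeFace_singleton hw).isFaceOf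

lemma isEdgeOf_of_isCubeFace {d : ℕ} {W : Finset (Fin d → Fin 2)} {u v : Fin d → Fin 2}
    (huv : u ≠ v) (h : IsCubeFace W {u, v}) :
    IsEdgeOf (convexHull ℝ (toCube '' (W : Set (Fin d → Fin 2)))) (toCube u) (toCube v) := by
  refine ⟨toCube_injective.ne huv, ?_⟩
  have := h.isFaceOf
  rwa [Finset.coe_pair, Set.image_pair, convexHull_pair] at this

/-! ### Expansion of a polytope whose projection is a cube with small fibers -/

/-- The projection of the `d`-cube onto the first `k` coordinates. -/
def cubeProj {k d : ℕ} (h : k ≤ d) (w : Fin d → Fin 2) : Fin k → Fin 2 :=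
  fun i => w (Fin.castLE h i)

lemma cubeProj_surjective {k d : ℕ} (h : k ≤ d) : Function.Surjective (cubeProj h) := by
  intro z
  refine ⟨fun i => if hi : i.1 < k then z ⟨i, hi⟩ else 0, ?_⟩
  ext i
  simp [cubeProj]

/-- Restricting the projection on a set of coordinates cuts out a face. -/
lemma isCubeFace_filter_cubeProj {k d : ℕ} (h : k ≤ d) (W : Finset (Fin d → Fin 2))
    (p : Fin k → Prop) [DecidablePred p] (z : Fin k → Fin 2) :
    IsCubeFace W (W.filter fun w => ∀ i, p i → cubeProj h w i = z i) := by
  obtain ⟨y, rfl⟩ := cubeProj_surjective h z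
  convert isCubeFace_filter W (fun j => ∃ i, p i ∧ Fin.castLE h i = j) y using 4
  simp [cubeProj]

lemma eq_or_eq_flipAt {k : ℕ} {y z : Fin k → Fin 2} {i : Fin k}
    (h : ∀ j, j ≠ i → y j = z j) : y = z ∨ y = flipAt z i := by
  by_cases hi : y i = z i
  · refine Or.inl (funext fun j => ?_)
    by_cases hj : j = i
    · rw [hj, hi]
    · exact h j hj
  · refine Or.inr (funext fun j => ?_)
    by_cases hj : j = i
    · subst hj
      simp only [flipAt, Function.update_self]
      omega
    · rw [flipAt, Function.update_of_ne hj, h j hj]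

/-- If every fiber of the projection has between `1` and `M` points and `N` contains an outside
point of every face that is cut by `S`, then `|S| ≤ M (2 √k + 1) |N|`. -/
theorem card_le_of_fibers {k d M : ℕ} (h : k ≤ d) (W S N : Finset (Fin d → Fin 2))
    (hne : ∀ z, ∃ w ∈ W, cubeProj h w = z)
    (hM : ∀ z, (W.filter fun w => cubeProj h w = z).card ≤ M)
    (hSW : S ⊆ W) (hS : 2 * S.card ≤ W.card)
    (hN : ∀ F, IsCubeFace W F → (∃ u ∈ F, u ∈ S) → (∃ v ∈ F, v ∉ S) →
      ∃ v ∈ F, v ∉ S ∧ v ∈ N) :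
    (S.card : ℝ) ≤ M * (2 * Real.sqrt k + 1) * N.card := by
  let A : Finset (Fin k → Fin 2) :=
    Finset.univ.filter fun z => ∃ w ∈ W, cubeProj h w = z ∧ w ∉ S
  have hA : ∀ z, z ∈ A ↔ ∃ w ∈ W, cubeProj h w = z ∧ w ∉ S := fun z => by simp [A]
  let B := N.image (cubeProj h)
  have hB : (B.card : ℝ) ≤ N.card := by exact_mod_cast Finset.card_image_le
  have hboundary : ∀ z ∈ A, ∀ i, flipAt z i ∉ A → z ∈ B := by
    intro z hz i hzi
    obtain ⟨v, hvW, hvz, hvS⟩ := (hA z).1 hz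
    obtain ⟨u, huW, huz⟩ := hne (flipAt z i)
    have huS : u ∈ S := by
      by_contra hu
      exact hzi ((hA _).2 ⟨u, huW, huz, hu⟩)
    obtain ⟨w, hw, hwS, hwN⟩ := hN _ (isCubeFace_filter_cubeProj h W (· ≠ i) z)
      ⟨u, Finset.mem_filter.2 ⟨huW, fun j hj => by
        rw [huz, flipAt, Function.update_of_ne hj]⟩, huS⟩
      ⟨v, Finset.mem_filter.2 ⟨hvW, fun j _ => by rw [hvz]⟩, hvS⟩
    rw [Finset.mem_filter] at hw
    rcases eq_or_eq_flipAt hw.2 with hwz | hwz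
    · exact Finset.mem_image.2 ⟨w, hwN, hwz⟩
    · exact absurd ((hA _).2 ⟨w, hw.1, hwz, hwS⟩) hzi
  have hiso := card_mul_le_of_innerBoundary_subset A B hboundary
  have hSimage : S.image (cubeProj h) ⊆ Aᶜ ∪ B := by
    intro z hz
    obtain ⟨u, hu, huz⟩ := Finset.mem_image.1 hz
    rw [Finset.mem_union, Finset.mem_compl, or_iff_not_imp_left, not_not]
    intro hzA
    obtain ⟨v, hvW, hvz, hvS⟩ := (hA z).1 hzA
    obtain ⟨w, hw, -, hwN⟩ := hN _ (isCubeFace_filter_cubeProj h W (fun _ => True) z)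
      ⟨u, Finset.mem_filter.2 ⟨hSW hu, fun j _ => by rw [huz]⟩, hu⟩
      ⟨v, Finset.mem_filter.2 ⟨hvW, fun j _ => by rw [hvz]⟩, hvS⟩
    exact Finset.mem_image.2
      ⟨w, hwN, funext fun j => (Finset.mem_filter.1 hw).2 j trivial⟩
  have hcompl : (W \ S).image (cubeProj h) ⊆ A := by
    intro z hz
    obtain ⟨w, hw, hwz⟩ := Finset.mem_image.1 hz
    rw [Finset.mem_sdiff] at hw
    exact (hA z).2 ⟨w, hw.1, hwz, hw.2⟩
  have hfiber : ∀ T ⊆ W, T.card ≤ M * (T.image (cubeProj h)).card := fun T hT =>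
    Finset.card_le_mul_card_image T M fun z _ =>
      (Finset.card_le_card (Finset.filter_subset_filter _ hT)).trans (hM z)
  have hAc : (Aᶜ.card : ℝ) = 2 ^ k - A.card := by
    rw [Finset.card_compl, Nat.cast_sub (Finset.card_le_univ A)]
    simp
  have hpow : (0 : ℝ) < 2 ^ k := by positivity
  have hM0 : (0 : ℝ) ≤ M := Nat.cast_nonneg _
  have hN0 : (0 : ℝ) ≤ N.card := Nat.cast_nonneg _
  have hk0 := Real.sqrt_nonneg (k : ℝ)
  have hiso' : (A.card : ℝ) * (2 ^ k - A.card) ≤ 2 ^ k * (Real.sqrt k * N.card) :=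
    hiso.trans (by gcongr)
  rcases le_total (2 ^ k : ℝ) (2 * A.card) with hhalf | hhalf
  · have h1 : (S.card : ℝ) ≤ M * (Aᶜ.card + B.card) := by
      exact_mod_cast (hfiber S hSW).trans (Nat.mul_le_mul_left M
        ((Finset.card_le_card hSimage).trans (Finset.card_union_le _ _)))
    have h2 : (2 ^ k - A.card : ℝ) ≤ 2 * (Real.sqrt k * N.card) := by
      refine le_of_mul_le_mul_left ?_ hpow
      have : (0 : ℝ) ≤ 2 ^ k - A.card := hAc ▸ Nat.cast_nonneg _
      nlinarith
    rw [hAc] at h1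
    calc (S.card : ℝ) ≤ _ := h1
      _ ≤ M * (2 * (Real.sqrt k * N.card) + N.card) := by gcongr
      _ = _ := by ring
  · have h1 : (S.card : ℝ) ≤ M * A.card := by
      have hle : S.card ≤ (W \ S).card := by
        rw [Finset.card_sdiff_of_subset hSW]
        omega
      exact_mod_cast hle.trans ((hfiber _ Finset.sdiff_subset).trans
        (Nat.mul_le_mul_left M (Finset.card_le_card hcompl)))
    have h2 : (A.card : ℝ) ≤ 2 * (Real.sqrt k * N.card) := by
      refine le_of_mul_le_mul_left ?_ hpow
      have : (0 : ℝ) ≤ A.card := Nat.cast_nonneg _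
      nlinarith
    calc (S.card : ℝ) ≤ _ := h1
      _ ≤ M * (2 * (Real.sqrt k * N.card) + N.card) := by gcongr; linarith
      _ = _ := by ring

/-- Vertex expansion of a 0/1 polytope whose projection to the first `k` coordinates is a cube
with all fibers of size at most `M`. -/
theorem vertexExpansionAtLeast_of_fibers {k d M : ℕ} (h : k ≤ d) (W : Finset (Fin d → Fin 2))
    (hne : ∀ z, ∃ w ∈ W, cubeProj h w = z)
    (hM : ∀ z, (W.filter fun w => cubeProj h w = z).card ≤ M) {α : ℝ} (hα : 0 ≤ α)
    (hαM : α * (M * (2 * Real.sqrt k + 1)) ≤ 1) :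
    VertexExpansionAtLeast (convexHull ℝ (toCube '' (W : Set (Fin d → Fin 2)))) α := by
  intro S hSV _ hcard
  rw [polyVerts_convexHull_toCube] at hSV hcard
  obtain ⟨T, hTW, rfl⟩ : ∃ T ⊆ W, toCube '' (T : Set (Fin d → Fin 2)) = S := by
    refine ⟨W.filter fun w => toCube w ∈ S, Finset.filter_subset _ _, Set.Subset.antisymm ?_ ?_⟩
    · rintro _ ⟨w, hw, rfl⟩
      exact (Finset.mem_filter.1 hw).2
    · intro x hx
      obtain ⟨w, hw, rfl⟩ := hSV hx
      exact ⟨w, Finset.mem_filter.2 ⟨hw, hx⟩, rfl⟩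
  rw [Set.ncard_image_of_injective _ toCube_injective, Set.ncard_coe_finset] at hcard ⊢
  rw [Set.ncard_image_of_injective _ toCube_injective, Set.ncard_coe_finset] at hcard
  set P := convexHull ℝ (toCube '' (W : Set (Fin d → Fin 2))) with hP
  let N : Finset (Fin d → Fin 2) :=
    W.filter fun v => toCube v ∈ polyNbhd P (toCube '' (T : Set (Fin d → Fin 2)))
  have hNP : polyNbhd P (toCube '' (T : Set (Fin d → Fin 2))) = toCube '' (N : Set _) := by
    ext x
    refine ⟨fun hx => ?_, ?_⟩
    · have hxv : x ∈ polyVerts P := hx.1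
      rw [hP, polyVerts_convexHull_toCube] at hxv
      obtain ⟨v, hv, rfl⟩ := hxv
      exact ⟨v, Finset.mem_filter.2 ⟨hv, hx⟩, rfl⟩
    · rintro ⟨v, hv, rfl⟩
      exact (Finset.mem_filter.1 hv).2
  rw [hNP, Set.ncard_image_of_injective _ toCube_injective, Set.ncard_coe_finset]
  have hmain := card_le_of_fibers h W T N hne hM hTW hcard fun F hF hu hv => by
    obtain ⟨u, -, v, hvF, huT, hvT, huv⟩ := exists_bichromatic_edge F hF hu hv
    have hvW : v ∈ W := by
      obtain ⟨c, c₀, -, rfl⟩ := hF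
      exact (Finset.mem_filter.1 hvF).1
    refine ⟨v, hvF, hvT, Finset.mem_filter.2 ⟨hvW, ?_, ?_, toCube u, ⟨u, huT, rfl⟩, ?_⟩⟩
    · have : toCube v ∈ polyVerts P := by
        rw [hP, polyVerts_convexHull_toCube]
        exact ⟨v, hvW, rfl⟩
      exact this
    · rwa [toCube_injective.mem_set_image]
    · exact isEdgeOf_of_isCubeFace (fun h => hvT (h ▸ huT)) huv
  calc α * T.card ≤ α * (M * (2 * Real.sqrt k + 1) * N.card) := by gcongr
    _ = α * (M * (2 * Real.sqrt k + 1)) * N.card := by ring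
    _ ≤ 1 * N.card := mul_le_mul_of_nonneg_right hαM (Nat.cast_nonneg _)
    _ = N.card := one_mul _

/-! ### Balls into bins -/

lemma card_fiber_cubeProj {k d : ℕ} (h : k ≤ d) (z : Fin k → Fin 2) :
    (Finset.univ.filter fun w : Fin d → Fin 2 => cubeProj h w = z).card = 2 ^ (d - k) := by
  obtain ⟨m, rfl⟩ := Nat.exists_eq_add_of_le h
  have himage : (Finset.univ.filter fun w : Fin (k + m) → Fin 2 => cubeProj h w = z) =
      Finset.univ.image fun y : Fin m → Fin 2 => Fin.append z y := by
    ext w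
    simp only [Finset.mem_filter, Finset.mem_univ, true_and, Finset.mem_image]
    constructor
    · rintro rfl
      exact ⟨fun j => w (Fin.natAdd k j), Fin.append_castAdd_natAdd⟩
    · rintro ⟨y, rfl⟩
      ext i
      exact congrArg Fin.val (Fin.append_left z y i)
  rw [himage, Finset.card_image_of_injective _ fun y y' hy => ?_]
  · simp
  · ext j
    have := congrFun hy (Fin.natAdd k j)
    simpa using congrArg Fin.val this

/-- The number of samples falling in the fiber over `z`. -/
noncomputable def load {n k d : ℕ} (h : k ≤ d) (ω : Fin n → Fin d → Fin 2) (z : Fin k → Fin 2) :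
    ℕ :=
  (Finset.univ.filter fun i => cubeProj h (ω i) = z).card

/-- The generating function of the load of a fiber. -/
lemma sum_pow_load {n k d : ℕ} (h : k ≤ d) (z : Fin k → Fin 2) (x : ℝ) :
    ∑ ω : Fin n → Fin d → Fin 2, x ^ load h ω z =
      (2 ^ d : ℝ) ^ n * (1 + (x - 1) / 2 ^ k) ^ n := by
  have hprod : ∀ ω : Fin n → Fin d → Fin 2,
      x ^ load h ω z = ∏ i, if cubeProj h (ω i) = z then x else 1 := fun ω => by
    rw [load, Finset.prod_ite]
    simp
  have hone : ∑ w : Fin d → Fin 2, (if cubeProj h w = z then x else 1) =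
      2 ^ d * (1 + (x - 1) / 2 ^ k) := by
    have hsplit : ∀ w : Fin d → Fin 2, (if cubeProj h w = z then x else 1) =
        1 + (x - 1) * if cubeProj h w = z then 1 else 0 := fun w => by split_ifs <;> ring
    simp only [hsplit]
    rw [Finset.sum_add_distrib, ← Finset.mul_sum, Finset.sum_boole, card_fiber_cubeProj]
    have hpow : (2 : ℝ) ^ d = 2 ^ (d - k) * 2 ^ k := by rw [← pow_add, Nat.sub_add_cancel h]
    simp only [Finset.sum_const, Finset.card_univ, Fintype.card_fun, Fintype.card_fin,
      nsmul_eq_mul, mul_one, Nat.cast_pow, Nat.cast_ofNat, hpow]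
    field_simp
  simp only [hprod]
  rw [← Fintype.prod_sum fun (_ : Fin n) (w : Fin d → Fin 2) =>
    if cubeProj h w = z then x else 1]
  simp only [hone, Finset.prod_const, Finset.card_univ, Fintype.card_fin, mul_pow]

lemma sum_pow_load_le {n k d : ℕ} (h : k ≤ d) (z : Fin k → Fin 2) {x : ℝ} (hx : 0 ≤ x) :
    ∑ ω : Fin n → Fin d → Fin 2, x ^ load h ω z ≤
      (2 ^ d : ℝ) ^ n * Real.exp ((x - 1) * (n / 2 ^ k)) := by
  rw [sum_pow_load]
  have hexp : Real.exp ((x - 1) * (n / 2 ^ k)) = Real.exp ((x - 1) / 2 ^ k) ^ n := by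
    rw [← Real.exp_nat_mul]
    congr 1
    ring
  rw [hexp]
  have hbase : 0 ≤ 1 + (x - 1) / 2 ^ k := by
    have hk : (1 : ℝ) ≤ 2 ^ k := one_le_pow₀ (by norm_num)
    have : (1 + (x - 1) / 2 ^ k : ℝ) = (2 ^ k - 1 + x) / 2 ^ k := by field_simp; ring
    rw [this]
    exact div_nonneg (by linarith) (by positivity)
  gcongr
  linarith [Real.add_one_le_exp ((x - 1) / 2 ^ k)]

lemma card_load_eq_zero_le {n k d : ℕ} (h : k ≤ d) (z : Fin k → Fin 2)
    (hn : (d : ℝ) ≤ n / 2 ^ k) :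
    ((Finset.univ.filter fun ω : Fin n → Fin d → Fin 2 => load h ω z = 0).card : ℝ) ≤
      (2 ^ d : ℝ) ^ n * (3 / 8) ^ d := by
  calc ((Finset.univ.filter fun ω : Fin n → Fin d → Fin 2 => load h ω z = 0).card : ℝ)
      = ∑ ω : Fin n → Fin d → Fin 2, (0 : ℝ) ^ load h ω z := by
        rw [← Finset.sum_boole]
        refine Finset.sum_congr rfl fun ω _ => ?_
        rw [zero_pow_eq]
    _ ≤ (2 ^ d : ℝ) ^ n * Real.exp ((0 - 1) * (n / 2 ^ k)) := sum_pow_load_le h z le_rfl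
    _ ≤ (2 ^ d : ℝ) ^ n * Real.exp (d * (-1)) := by
        refine mul_le_mul_of_nonneg_left (Real.exp_le_exp.2 ?_) (by positivity)
        linarith
    _ ≤ (2 ^ d : ℝ) ^ n * (3 / 8) ^ d := by
        rw [Real.exp_nat_mul]
        gcongr
        rw [Real.exp_neg, inv_le_comm₀ (Real.exp_pos 1) (by norm_num)]
        linarith [Real.exp_one_gt_d9]

lemma card_lt_load_le {n k d : ℕ} (h : k ≤ d) (z : Fin k → Fin 2)
    (hn : (n : ℝ) / 2 ^ k ≤ 2 * d) :
    ((Finset.univ.filter fun ω : Fin n → Fin d → Fin 2 => 8 * d < load h ω z).card : ℝ) ≤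
      (2 ^ d : ℝ) ^ n * (3 / 8) ^ d := by
  have hmarkov :
      ((Finset.univ.filter fun ω : Fin n → Fin d → Fin 2 => 8 * d < load h ω z).card : ℝ) *
        256 ^ d ≤ ∑ ω : Fin n → Fin d → Fin 2, (2 : ℝ) ^ load h ω z := by
    rw [← Finset.sum_boole, Finset.sum_mul]
    refine Finset.sum_le_sum fun ω _ => ?_
    split_ifs with hω
    · rw [one_mul, show (256 : ℝ) = 2 ^ 8 by norm_num, ← pow_mul]
      exact pow_le_pow_right₀ (by norm_num) hω.le
    · simp
  have hexp : Real.exp ((2 - 1) * (n / 2 ^ k)) ≤ 9 ^ d := by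
    calc Real.exp ((2 - 1) * (n / 2 ^ k)) ≤ Real.exp (d * 2) := Real.exp_le_exp.2 (by linarith)
      _ = (Real.exp 1 ^ 2) ^ d := by rw [Real.exp_nat_mul, ← Real.exp_nat_mul 1 2]; norm_num
      _ ≤ 9 ^ d := by
          gcongr
          have h1 := Real.exp_one_lt_d9
          have h0 := Real.exp_pos 1
          nlinarith
  refine le_of_mul_le_mul_right ?_ (by positivity : (0 : ℝ) < 256 ^ d)
  calc _ ≤ _ := hmarkov
    _ ≤ (2 ^ d : ℝ) ^ n * Real.exp ((2 - 1) * (n / 2 ^ k)) := sum_pow_load_le h z (by norm_num)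
    _ ≤ (2 ^ d : ℝ) ^ n * 9 ^ d := by gcongr
    _ ≤ (2 ^ d : ℝ) ^ n * 96 ^ d := by gcongr; norm_num
    _ = _ := by rw [mul_assoc, ← mul_pow]; norm_num

/-- A union bound over the fibers. -/
lemma card_exists_le {n k d : ℕ} (h : k ≤ d)
    (p : (Fin n → Fin d → Fin 2) → (Fin k → Fin 2) → Prop) [∀ ω, DecidablePred (p ω)]
    (hp : ∀ z, ((Finset.univ.filter fun ω => p ω z).card : ℝ) ≤ (2 ^ d : ℝ) ^ n * (3 / 8) ^ d) :
    ((Finset.univ.filter fun ω => ∃ z, p ω z).card : ℝ) ≤ (2 ^ d : ℝ) ^ n * (3 / 4) ^ d := by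
  have hunion : (Finset.univ.filter fun ω => ∃ z, p ω z) =
      Finset.univ.biUnion fun z => Finset.univ.filter fun ω => p ω z := by
    ext ω; simp
  have hcard : ((Finset.univ.filter fun ω => ∃ z, p ω z).card : ℝ) ≤
      ∑ z, ((Finset.univ.filter fun ω => p ω z).card : ℝ) := by
    rw [hunion]
    exact_mod_cast Finset.card_biUnion_le
  calc _ ≤ _ := hcard
    _ ≤ ∑ _z : Fin k → Fin 2, (2 ^ d : ℝ) ^ n * (3 / 8) ^ d := Finset.sum_le_sum fun z _ => hp z
    _ = 2 ^ k * ((2 ^ d : ℝ) ^ n * (3 / 8) ^ d) := by simp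
    _ ≤ 2 ^ d * ((2 ^ d : ℝ) ^ n * (3 / 8) ^ d) := by gcongr; norm_num
    _ = (2 ^ d : ℝ) ^ n * (2 * (3 / 8)) ^ d := by rw [mul_pow]; ring
    _ = _ := by norm_num

/-- If all loads are positive and the number of distinct samples in a fiber is at most `8 d`, the
random polytope expands. -/
lemma vertexExpansionAtLeast_of_load {n k d : ℕ} (hd : 0 < d) (h : k ≤ d)
    (ω : Fin n → Fin d → Fin 2) (hpos : ∀ z, load h ω z ≠ 0)
    (hle : ∀ z, ((Finset.univ.image ω).filter fun w => cubeProj h w = z).card ≤ 8 * d) :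
    VertexExpansionAtLeast (convexHull ℝ (Set.range fun i : Fin n => toCube (ω i)))
      (1 / 24 / ((d : ℝ) * Real.sqrt d)) := by
  have hd1 : (1 : ℝ) ≤ d := by exact_mod_cast hd
  have hs1 : 1 ≤ Real.sqrt d := Real.one_le_sqrt.2 hd1
  have hks : Real.sqrt k ≤ Real.sqrt d := Real.sqrt_le_sqrt (by exact_mod_cast h)
  have hrange : (Set.range fun i : Fin n => toCube (ω i)) =
      toCube '' ((Finset.univ.image ω : Finset _) : Set (Fin d → Fin 2)) := by
    rw [Finset.coe_image, Finset.coe_univ, Set.image_univ, ← Set.range_comp]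
    rfl
  rw [hrange]
  refine vertexExpansionAtLeast_of_fibers h _ (fun z => ?_) hle (by positivity) ?_
  · obtain ⟨i, hi⟩ := Finset.card_ne_zero.1 (hpos z)
    exact ⟨ω i, Finset.mem_image_of_mem _ (Finset.mem_univ i), (Finset.mem_filter.1 hi).2⟩
  · rw [div_mul_eq_mul_div, div_le_one (by positivity)]
    push_cast
    nlinarith

lemma card_filter_image_le_load {n k d : ℕ} (h : k ≤ d) (ω : Fin n → Fin d → Fin 2)
    (z : Fin k → Fin 2) :
    ((Finset.univ.image ω).filter fun w => cubeProj h w = z).card ≤ load h ω z := by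
  rw [Finset.filter_image]
  exact Finset.card_image_le

lemma card_filter_cubeProj_self_le {d : ℕ} (W : Finset (Fin d → Fin 2)) (z : Fin d → Fin 2) :
    (W.filter fun w => cubeProj le_rfl w = z).card ≤ 1 := by
  refine Finset.card_le_one.2 fun u hu v hv => ?_
  exact (Finset.mem_filter.1 hu).2.trans (Finset.mem_filter.1 hv).2.symm

/-- All but an exponentially small fraction of the samples give an expanding polytope. -/
theorem card_not_vertexExpansionAtLeast_le {n d : ℕ} (hd : 0 < d) :
    ((Finset.univ.filter fun ω : Fin n → Fin d → Fin 2 => ¬ VertexExpansionAtLeast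
        (convexHull ℝ (Set.range fun i : Fin n => toCube (ω i)))
        (1 / 24 / ((d : ℝ) * Real.sqrt d))).card : ℝ) ≤
      (2 ^ d : ℝ) ^ n * (2 * (3 / 4) ^ d) := by
  have hd' : (0 : ℝ) < d := by exact_mod_cast hd
  rcases lt_or_ge n d with hn | hn
  · rw [Finset.filter_eq_empty_iff.2]
    · simpa using by positivity
    intro ω _
    rw [not_not]
    rcases Nat.eq_zero_or_pos n with rfl | hn0
    · intro S hSV hS
      rw [Set.range_eq_empty, ← Set.image_empty toCube, ← Finset.coe_empty,
        polyVerts_convexHull_toCube] at hSV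
      simp only [Finset.coe_empty, Set.image_empty, Set.subset_empty_iff] at hSV
      exact absurd hSV hS.ne_empty
    · have hload : ∀ z, load (Nat.zero_le d) ω z = n := fun z => by
        have hz : ∀ w, cubeProj (Nat.zero_le d) w = z := fun w => Subsingleton.elim _ _
        simp [load, hz]
      refine vertexExpansionAtLeast_of_load hd (Nat.zero_le d) ω
        (fun z => by rw [hload]; omega) fun z => ?_
      have := card_filter_image_le_load (Nat.zero_le d) ω z
      rw [hload] at this
      omega
  · have hq : n / d ≠ 0 := (Nat.div_pos hn hd).ne'
    have hlow : 2 ^ Nat.log 2 (n / d) * d ≤ n :=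
      (Nat.le_div_iff_mul_le hd).1 (Nat.pow_log_le_self 2 hq)
    have hhigh : n < 2 ^ (Nat.log 2 (n / d) + 1) * d :=
      (Nat.div_lt_iff_lt_mul hd).1 (Nat.lt_pow_succ_log_self (by norm_num) _)
    have hT : (0 : ℝ) ≤ (2 ^ d : ℝ) ^ n * (3 / 4) ^ d := by positivity
    rcases le_or_gt (Nat.log 2 (n / d)) d with hk | hk
    · generalize Nat.log 2 (n / d) = k at hlow hhigh hk
      have h0 := card_exists_le hk (fun ω z => load hk ω z = 0) fun z =>
        card_load_eq_zero_le (n := n) hk z (by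
          rw [le_div_iff₀ (by positivity), mul_comm]
          exact_mod_cast hlow)
      have h1 := card_exists_le hk (fun ω z => 8 * d < load hk ω z) fun z =>
        card_lt_load_le (n := n) hk z (by
          rw [div_le_iff₀ (by positivity)]
          have : (n : ℝ) ≤ 2 ^ (k + 1) * d := by exact_mod_cast hhigh.le
          rw [pow_succ] at this
          linarith)
      have hsub : (Finset.univ.filter fun ω : Fin n → Fin d → Fin 2 => ¬ VertexExpansionAtLeast
          (convexHull ℝ (Set.range fun i : Fin n => toCube (ω i)))
          (1 / 24 / ((d : ℝ) * Real.sqrt d))) ⊆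
          (Finset.univ.filter fun ω => ∃ z, load hk ω z = 0) ∪
          (Finset.univ.filter fun ω => ∃ z, 8 * d < load hk ω z) := by
        intro ω hω
        by_contra hnot
        simp only [Finset.mem_union, Finset.mem_filter, Finset.mem_univ, true_and, not_or,
          not_exists, not_lt] at hnot
        exact (Finset.mem_filter.1 hω).2 (vertexExpansionAtLeast_of_load hd hk ω hnot.1
          fun z => (card_filter_image_le_load hk ω z).trans (hnot.2 z))
      have hcard : ((Finset.univ.filter fun ω : Fin n → Fin d → Fin 2 =>
          ¬ VertexExpansionAtLeast (convexHull ℝ (Set.range fun i : Fin n => toCube (ω i)))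
          (1 / 24 / ((d : ℝ) * Real.sqrt d))).card : ℝ) ≤
          (Finset.univ.filter fun ω : Fin n → Fin d → Fin 2 => ∃ z, load hk ω z = 0).card +
          (Finset.univ.filter fun ω : Fin n → Fin d → Fin 2 =>
            ∃ z, 8 * d < load hk ω z).card := by
        exact_mod_cast (Finset.card_le_card hsub).trans (Finset.card_union_le _ _)
      linarith
    · have hnd : 2 ^ d * d ≤ n := le_trans
        (Nat.mul_le_mul_right d (Nat.pow_le_pow_right (by norm_num) hk.le)) hlow
      have h0 := card_exists_le le_rfl (fun ω z => load le_rfl ω z = 0) fun z =>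
        card_load_eq_zero_le (n := n) (d := d) le_rfl z (by
          rw [le_div_iff₀ (by positivity), mul_comm]
          exact_mod_cast hnd)
      have hsub : (Finset.univ.filter fun ω : Fin n → Fin d → Fin 2 => ¬ VertexExpansionAtLeast
          (convexHull ℝ (Set.range fun i : Fin n => toCube (ω i)))
          (1 / 24 / ((d : ℝ) * Real.sqrt d))) ⊆
          Finset.univ.filter fun ω => ∃ z, load le_rfl ω z = 0 := by
        intro ω hω
        by_contra hnot
        simp only [Finset.mem_filter, Finset.mem_univ, true_and, not_exists] at hnot
        exact (Finset.mem_filter.1 hω).2 (vertexExpansionAtLeast_of_load hd le_rfl ω hnot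
          fun z => (card_filter_cubeProj_self_le _ z).trans (by omega))
      have hcard := (Nat.cast_le (α := ℝ)).2 (Finset.card_le_card hsub)
      linarith

/-- Vertex-expansion theorem for random 0/1 polytopes (balls-into-bins model): if `P`
is the convex hull of `n` i.i.d. uniform points of `{0,1}^d`, then there is a constant
`C > 0` such that with probability tending to 1 as `d → ∞` (uniformly in `n`), the
vertex expansion of the graph of `P` is at least `C/d^(3/2)`. -/
theorem vertex_expansion_random_polytope :
    ∃ C : ℝ, 0 < C ∧ ∀ ε : ℝ, 0 < ε → ∃ D : ℕ, ∀ d : ℕ, D ≤ d → ∀ n : ℕ,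
      1 - ε ≤
        (((Finset.univ : Finset (Fin n → Fin d → Fin 2)).filter
            fun ω => VertexExpansionAtLeast
              (convexHull ℝ (Set.range fun i : Fin n => toCube (ω i)))
              (C / ((d : ℝ) * Real.sqrt d))).card : ℝ)
          / (Fintype.card (Fin n → Fin d → Fin 2)) := by
  refine ⟨1 / 24, by norm_num, fun ε hε => ?_⟩
  obtain ⟨D, hD⟩ := exists_pow_lt_of_lt_one (half_pos hε) (by norm_num : (3 / 4 : ℝ) < 1)
  refine ⟨D + 1, fun d hd n => ?_⟩
  have hbad := card_not_vertexExpansionAtLeast_le (n := n) (show 0 < d by omega)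
  have hpow : (3 / 4 : ℝ) ^ d ≤ (3 / 4) ^ D :=
    pow_le_pow_of_le_one (by norm_num) (by norm_num) (by omega)
  have htotal : (Fintype.card (Fin n → Fin d → Fin 2) : ℝ) = (2 ^ d : ℝ) ^ n := by simp
  have hsum := Finset.card_filter_add_card_filter_not
    (s := (Finset.univ : Finset (Fin n → Fin d → Fin 2)))
    fun ω => VertexExpansionAtLeast (convexHull ℝ (Set.range fun i : Fin n => toCube (ω i)))
      (1 / 24 / ((d : ℝ) * Real.sqrt d))
  rw [Finset.card_univ] at hsum
  have hsum' := congrArg (Nat.cast (R := ℝ)) hsum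
  rw [Nat.cast_add, htotal] at hsum'
  have hpos : (0 : ℝ) < (2 ^ d : ℝ) ^ n := by positivity
  rw [htotal, le_div_iff₀ hpos]
  have hsmall : (2 ^ d : ℝ) ^ n * (2 * (3 / 4) ^ d) ≤ (2 ^ d : ℝ) ^ n * ε := by
    gcongr
    linarith
  linarith
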